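/- Let k ≥ 2, let L : ℝ^n × ℝ^n → ℝ be a C^k regular Lagrangian with a C^k Euler–Lagrange flow F_t defined on an open domain containing {0} × (ℝ^n × ℝ^n), let α⁺, α⁻ be as in a discretization, and let (L_h, ψ, α⁺, α⁻) be the associated exact discretization, assumed to form a C^k discretization of L. Then there is an open set U ⊆ ℝ × (ℝ^n × ℝ^n) × (ℝ^n × ℝ^n) containing {0} × Δ, where Δ := {(w, w) : w ∈ ℝ^n × ℝ^n}, such that for all (h, v, ṽ) ∈ U with h > 0: ṽ = F_h(v) if and only if (h, v, ṽ) is critical for (L_h, ψ, α⁺, α⁻). -/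

import Mathlib

open Set

noncomputable section

/-- The model for ℝ^n. -/
abbrev Vec (n : ℕ) : Type := Fin n → ℝ

/-- The phase space ℝ^n × ℝ^n. -/
abbrev Phase (n : ℕ) : Type := Vec n × Vec n

/-- A C^k discretization of the tangent bundle of ℝ^n. -/
structure TBDisc (n : ℕ) (k : ℕ) : Type where
  ψ : ℝ → ℝ → Phase n → Vec n
  dom : Set (ℝ × ℝ × Phase n)
  dom_open : IsOpen dom
  dom_zero : ∀ w : Phase n, (0, 0, w) ∈ dom
  ψ_cont : ContinuousOn (fun p : ℝ × ℝ × Phase n => ψ p.1 p.2.1 p.2.2) dom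
  a : ℝ
  a_pos : 0 < a
  αp : ℝ → ℝ
  αm : ℝ → ℝ
  αp_smooth : ContDiffOn ℝ 1 αp (Ico 0 a)
  αm_smooth : ContDiffOn ℝ 1 αm (Ico 0 a)
  αp_nonneg : ∀ h ∈ Ico (0:ℝ) a, 0 ≤ αp h
  αm_nonpos : ∀ h ∈ Ico (0:ℝ) a, αm h ≤ 0
  α_sub : ∀ h ∈ Ico (0:ℝ) a, αp h - αm h = h
  ψ_init : ∀ h w, (h, (0:ℝ), w) ∈ dom → ψ h 0 w = w.1
  ψ_vel : ∀ h w, (h, (0:ℝ), w) ∈ dom → HasDerivAt (fun t => ψ h t w) w.2 0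
  bdom : Set (ℝ × Phase n)
  bdom_open : IsOpen bdom
  bdom_zero : ∀ w : Phase n, ((0:ℝ), w) ∈ bdom
  bp_smooth : ContDiffOn ℝ k (fun p : ℝ × Phase n => ψ p.1 (αp p.1) p.2) bdom
  bm_smooth : ContDiffOn ℝ k (fun p : ℝ × Phase n => ψ p.1 (αm p.1) p.2) bdom
  αpdot : ℝ
  αmdot : ℝ
  αp_deriv : HasDerivWithinAt αp αpdot (Ico 0 a) 0
  αm_deriv : HasDerivWithinAt αm αmdot (Ico 0 a) 0
  bp_deriv : ∀ w : Phase n,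
    HasDerivWithinAt (fun h => ψ h (αp h) w) (αpdot • w.2) (Ici 0) 0
  bm_deriv : ∀ w : Phase n,
    HasDerivWithinAt (fun h => ψ h (αm h) w) (αmdot • w.2) (Ici 0) 0

/-- The boundary map ∂⁺. -/
def TBDisc.bp {n k : ℕ} (D : TBDisc n k) (h : ℝ) (w : Phase n) : Vec n :=
  D.ψ h (D.αp h) w

/-- The boundary map ∂⁻. -/
def TBDisc.bm {n k : ℕ} (D : TBDisc n k) (h : ℝ) (w : Phase n) : Vec n :=
  D.ψ h (D.αm h) w

/-- Criticality of a triple (h, v, ṽ) for a discrete variational principle with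
boundary maps `bp`, `bm` and discrete Lagrangian `Lh`. -/
def IsCriticalPt {n : ℕ} (bp bm : ℝ → Phase n → Vec n) (Lh : ℝ → Phase n → ℝ)
    (h : ℝ) (v vt : Phase n) : Prop :=
  bp h v = bm h vt ∧
  ∀ δv δvt : Phase n,
    fderiv ℝ (bm h) v δv = 0 →
    fderiv ℝ (bp h) vt δvt = 0 →
    fderiv ℝ (bp h) v δv = fderiv ℝ (bm h) vt δvt →
    fderiv ℝ (Lh h) v δv + fderiv ℝ (Lh h) vt δvt = 0

/-- A C^k discretization of a Lagrangian system L. -/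
structure LDisc (n k : ℕ) (L : Phase n → ℝ) extends TBDisc n k where
  Lh : ℝ → Phase n → ℝ
  Lh_smooth : ContDiff ℝ k (fun p : ℝ × Phase n => Lh p.1 p.2)
  Lh_zero : ∀ w : Phase n, Lh 0 w = 0
  Lh_deriv : ∀ w : Phase n, HasDerivAt (fun h => Lh h w) (L w) 0

/-- Regularity of a Lagrangian: the fiber second derivative is everywhere invertible. -/
def IsRegularLagrangian {n : ℕ} (L : Phase n → ℝ) : Prop :=
  ∀ q v : Vec n, Function.Bijective
    (fun u : Vec n => fderiv ℝ (fun w : Vec n => fderiv ℝ (fun x : Vec n => L (q, x)) w) v u)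

/-- An Euler–Lagrange flow for the Lagrangian L. -/
structure ELFlow (n : ℕ) (L : Phase n → ℝ) where
  flow : ℝ → Phase n → Phase n
  dom : Set (ℝ × Phase n)
  dom_open : IsOpen dom
  dom_zero : ∀ w : Phase n, ((0:ℝ), w) ∈ dom
  init : ∀ w : Phase n, flow 0 w = w
  vel : ∀ (w : Phase n) (t : ℝ), (t, w) ∈ dom →
    HasDerivAt (fun s => (flow s w).1) ((flow t w).2) t
  el : ∀ (w : Phase n) (t : ℝ), (t, w) ∈ dom →
    HasDerivAt (fun s => fderiv ℝ (fun u : Vec n => L ((flow s w).1, u)) (flow s w).2)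
      (fderiv ℝ (fun x : Vec n => L (x, (flow t w).2)) (flow t w).1) t


open Topology Filter Metric

/-- The fibre derivative (momentum) of `L`. -/
def momentum {n : ℕ} (L : Phase n → ℝ) (w : Phase n) : Vec n →L[ℝ] ℝ :=
  (fderiv ℝ L w).comp (ContinuousLinearMap.inr ℝ (Vec n) (Vec n))

/-- The spatial Jacobian of a time dependent map. -/
def spJac {n : ℕ} (F : ℝ × Phase n → Phase n) (p : ℝ × Phase n) : Phase n →L[ℝ] Phase n :=
  (fderiv ℝ F p).comp (ContinuousLinearMap.inr ℝ ℝ (Phase n))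

/-- First component of the spatial Jacobian. -/
def spJac1 {n : ℕ} (F : ℝ × Phase n → Phase n) (p : ℝ × Phase n) : Phase n →L[ℝ] Vec n :=
  (ContinuousLinearMap.fst ℝ (Vec n) (Vec n)).comp (spJac F p)

/-- Second component of the spatial Jacobian. -/
def spJac2 {n : ℕ} (F : ℝ × Phase n → Phase n) (p : ℝ × Phase n) : Phase n →L[ℝ] Vec n :=
  (ContinuousLinearMap.snd ℝ (Vec n) (Vec n)).comp (spJac F p)

lemma fderiv_fib {n : ℕ} {L : Phase n → ℝ} (hL : ContDiff ℝ 2 L) (q v : Vec n) :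
    fderiv ℝ (fun u : Vec n => L (q, u)) v = momentum L (q, v) := by
  have h1 : HasFDerivAt L (fderiv ℝ L (q, v)) (q, v) :=
    (hL.differentiable (by norm_num)).differentiableAt.hasFDerivAt
  exact (HasFDerivAt.comp v h1 (hasFDerivAt_prodMk_right q v)).fderiv

lemma fderiv_base {n : ℕ} {L : Phase n → ℝ} (hL : ContDiff ℝ 2 L) (q v : Vec n) :
    fderiv ℝ (fun u : Vec n => L (u, v)) q =
      (fderiv ℝ L (q, v)).comp (ContinuousLinearMap.inl ℝ (Vec n) (Vec n)) := by
  have h1 : HasFDerivAt L (fderiv ℝ L (q, v)) (q, v) :=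
    (hL.differentiable (by norm_num)).differentiableAt.hasFDerivAt
  exact (HasFDerivAt.comp q h1 (hasFDerivAt_prodMk_left q v)).fderiv

lemma momentum_contDiff {n : ℕ} {L : Phase n → ℝ} (hL : ContDiff ℝ 2 L) :
    ContDiff ℝ 1 (momentum L) := by
  have h1 : ContDiff ℝ 1 (fderiv ℝ L) := hL.fderiv_right (by norm_num)
  exact h1.clm_comp contDiff_const

lemma momentum_inj {n : ℕ} {L : Phase n → ℝ} (hL : ContDiff ℝ 2 L)
    (hreg : IsRegularLagrangian L) (w : Phase n) (u : Vec n)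
    (h : fderiv ℝ (momentum L) w (0, u) = 0) : u = 0 := by
  obtain ⟨q, v⟩ := w
  have h1 : HasFDerivAt (momentum L) (fderiv ℝ (momentum L) (q, v)) (q, v) :=
    ((momentum_contDiff hL).differentiable (by norm_num)).differentiableAt.hasFDerivAt
  have h2 := (HasFDerivAt.comp v h1 (hasFDerivAt_prodMk_right q v)).fderiv
  have h3 : (fun w : Vec n => fderiv ℝ (fun x : Vec n => L (q, x)) w) =
      momentum L ∘ (fun v => (q, v)) := by
    funext v; exact fderiv_fib hL q v
  apply (hreg q v).1
  simp only [h3, h2]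
  simpa [Prod.mk_zero_zero] using h

lemma momentum_locInj {n : ℕ} {L : Phase n → ℝ} (hL : ContDiff ℝ 2 L)
    (hreg : IsRegularLagrangian L) (w : Phase n) :
    ∀ᶠ x in 𝓝 (w, w), x.1.1 = x.2.1 → momentum L x.1 = momentum L x.2 → x.1 = x.2 := by
  set A := fderiv ℝ (momentum L) w with hA
  have hs : HasStrictFDerivAt (momentum L) A w :=
    (momentum_contDiff hL).contDiffAt.hasStrictFDerivAt (by norm_num)
  let B : Vec n →ₗ[ℝ] (Vec n →L[ℝ] ℝ) :=
    (A.comp (ContinuousLinearMap.inr ℝ (Vec n) (Vec n))).toLinearMap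
  have hB : LinearMap.ker B = ⊥ := by
    rw [LinearMap.ker_eq_bot']
    intro u hu
    exact momentum_inj hL hreg w u (by simpa [B] using hu)
  obtain ⟨K, hK, hKB⟩ := B.exists_antilipschitzWith hB
  have hK' : (0:ℝ) < K := hK
  have hc : (0:ℝ) < (2 * (K:ℝ))⁻¹ := by positivity
  filter_upwards [hs.isLittleO.def hc] with x hx h1 h2
  obtain ⟨⟨q, v⟩, ⟨q', v'⟩⟩ := x
  simp only at h1
  subst h1
  simp only [h2, sub_self, zero_sub, norm_neg, Prod.mk_sub_mk] at hx
  have h3 := hKB.le_mul_dist v v'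
  rw [dist_eq_norm, dist_eq_norm, ← map_sub] at h3
  have h4 : B (v - v') = A (0, v - v') := by simp [B]
  rw [h4] at h3
  have h5 : ‖((0 : Vec n), v - v')‖ = ‖v - v'‖ := by simp [Prod.norm_def]
  rw [h5] at hx
  have h6 : ‖v - v'‖ ≤ 2⁻¹ * ‖v - v'‖ := by
    calc ‖v - v'‖ ≤ K * ‖A (0, v - v')‖ := h3
      _ ≤ K * ((2 * (K:ℝ))⁻¹ * ‖v - v'‖) := by gcongr
      _ = 2⁻¹ * ‖v - v'‖ := by field_simp
  have h7 : ‖v - v'‖ = 0 := by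
    have := norm_nonneg (v - v'); linarith
  rw [norm_eq_zero, sub_eq_zero] at h7
  simp [h7]

section Flow

variable {n : ℕ} {F : ℝ × Phase n → Phase n} {dom : Set (ℝ × Phase n)}

lemma F_hasFDerivAt (ho : IsOpen dom) (hF : ContDiffOn ℝ 2 F dom) {p : ℝ × Phase n}
    (hp : p ∈ dom) : HasFDerivAt F (fderiv ℝ F p) p :=
  ((hF.contDiffAt (ho.mem_nhds hp)).differentiableAt (by norm_num)).hasFDerivAt

lemma fderivF_contDiffAt (ho : IsOpen dom) (hF : ContDiffOn ℝ 2 F dom) {p : ℝ × Phase n}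
    (hp : p ∈ dom) : ContDiffAt ℝ 1 (fderiv ℝ F) p :=
  (hF.contDiffAt (ho.mem_nhds hp)).fderiv_right (by norm_num)

lemma spJac_continuousAt (ho : IsOpen dom) (hF : ContDiffOn ℝ 2 F dom) {p : ℝ × Phase n}
    (hp : p ∈ dom) : ContinuousAt (spJac F) p :=
  (fderivF_contDiffAt ho hF hp).continuousAt.clm_comp continuousAt_const

lemma F_space (ho : IsOpen dom) (hF : ContDiffOn ℝ 2 F dom) {t : ℝ} {w : Phase n}
    (hp : (t, w) ∈ dom) : HasFDerivAt (fun w => F (t, w)) (spJac F (t, w)) w :=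
  HasFDerivAt.comp w (F_hasFDerivAt ho hF hp) (hasFDerivAt_prodMk_right t w)

lemma F_time (ho : IsOpen dom) (hF : ContDiffOn ℝ 2 F dom) {t : ℝ} {w : Phase n}
    (hp : (t, w) ∈ dom) : HasDerivAt (fun s => F (s, w)) (fderiv ℝ F (t, w) (1, 0)) t := by
  exact HasFDerivAt.comp_hasDerivAt (f := fun s : ℝ => (s, w)) t (F_hasFDerivAt ho hF hp)
    ((hasDerivAt_id t).prodMk (hasDerivAt_const t w))

lemma F_time_fst (ho : IsOpen dom) (hF : ContDiffOn ℝ 2 F dom)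
    (hvel : ∀ w t, (t, w) ∈ dom → HasDerivAt (fun s => (F (s, w)).1) ((F (t, w)).2) t)
    {p : ℝ × Phase n} (hp : p ∈ dom) : (fderiv ℝ F p (1, 0)).1 = (F p).2 :=
  ((hasFDerivAt_fst.comp_hasDerivAt p.1 (F_time ho hF hp))).unique (hvel p.2 p.1 hp)

lemma spJac1_deriv (ho : IsOpen dom) (hF : ContDiffOn ℝ 2 F dom)
    (hvel : ∀ w t, (t, w) ∈ dom → HasDerivAt (fun s => (F (s, w)).1) ((F (t, w)).2) t)
    {t : ℝ} {w : Phase n} (hp : (t, w) ∈ dom) :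
    HasDerivAt (fun s => spJac1 F (s, w)) (spJac2 F (t, w)) t := by
  set D2 := fderiv ℝ (fderiv ℝ F) (t, w) with hD2
  have h1 : HasFDerivAt (fderiv ℝ F) D2 (t, w) :=
    ((fderivF_contDiffAt ho hF hp).differentiableAt (by norm_num)).hasFDerivAt
  have h2 : HasDerivAt (fun s => fderiv ℝ F (s, w)) (D2 (1, 0)) t := by
    exact HasFDerivAt.comp_hasDerivAt (f := fun s : ℝ => (s, w)) t h1
      ((hasDerivAt_id t).prodMk (hasDerivAt_const t w))
  have h3 : HasDerivAt (fun s => spJac1 F (s, w))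
      ((ContinuousLinearMap.fst ℝ (Vec n) (Vec n)).comp
        ((D2 (1, 0)).comp (ContinuousLinearMap.inr ℝ ℝ (Phase n)))) t := by
    have := ((hasDerivAt_const t (ContinuousLinearMap.fst ℝ (Vec n) (Vec n))).clm_comp
      (h2.clm_comp (hasDerivAt_const t (ContinuousLinearMap.inr ℝ ℝ (Phase n)))))
    simpa [spJac1, spJac] using this
  have hsymm : IsSymmSndFDerivAt ℝ F (t, w) :=
    (hF.contDiffAt (ho.mem_nhds hp)).isSymmSndFDerivAt (by simp)
  have h4 : HasFDerivAt (fun p => (fderiv ℝ F p (1, 0)).1)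
      ((ContinuousLinearMap.fst ℝ (Vec n) (Vec n)).comp (D2.flip (1, 0))) (t, w) := by
    have := (h1.clm_apply (hasFDerivAt_const ((1 : ℝ), (0 : Phase n)) (t, w))).fst
    simpa using this
  have h5 : HasFDerivAt (fun p => (F p).2)
      ((ContinuousLinearMap.snd ℝ (Vec n) (Vec n)).comp (fderiv ℝ F (t, w))) (t, w) :=
    (F_hasFDerivAt ho hF hp).snd
  have h6 : (fun p => (F p).2) =ᶠ[𝓝 (t, w)] (fun p => (fderiv ℝ F p (1, 0)).1) := by
    filter_upwards [ho.mem_nhds hp] with p hp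
    exact (F_time_fst ho hF hvel hp).symm
  have h7 := (h4.congr_of_eventuallyEq h6).unique h5
  have h8 : spJac2 F (t, w) = ((ContinuousLinearMap.fst ℝ (Vec n) (Vec n)).comp
        ((D2 (1, 0)).comp (ContinuousLinearMap.inr ℝ ℝ (Phase n)))) := by
    refine ContinuousLinearMap.ext fun δ => ?_
    have := DFunLike.congr_fun h7 ((0:ℝ), δ)
    have hs := hsymm (1, 0) (0, δ)
    rw [← hD2] at hs
    simp only [spJac2, spJac, ContinuousLinearMap.comp_apply, ContinuousLinearMap.inr_apply,
      ContinuousLinearMap.flip_apply] at this ⊢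
    rw [hs, this]
  rw [h8]; exact h3

lemma F_ode {L : Phase n → ℝ} (hL : ContDiff ℝ 2 L) (hreg : IsRegularLagrangian L)
    (ho : IsOpen dom) (hF : ContDiffOn ℝ 2 F dom)
    (hvel : ∀ w t, (t, w) ∈ dom → HasDerivAt (fun s => (F (s, w)).1) ((F (t, w)).2) t)
    (hel : ∀ w t, (t, w) ∈ dom → HasDerivAt (fun s => momentum L (F (s, w)))
      ((fderiv ℝ L (F (t, w))).comp (ContinuousLinearMap.inl ℝ (Vec n) (Vec n))) t)
    (h0 : ∀ w, (0, w) ∈ dom) (hinit : ∀ w, F (0, w) = w)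
    {t : ℝ} {w : Phase n} (hp : (t, w) ∈ dom) :
    HasDerivAt (fun s => F (s, w)) (fderiv ℝ F (0, F (t, w)) (1, 0)) t := by
  have key : ∀ t w, (t, w) ∈ dom →
      fderiv ℝ (momentum L) (F (t, w)) (fderiv ℝ F (t, w) (1, 0)) =
      ((fderiv ℝ L (F (t, w))).comp (ContinuousLinearMap.inl ℝ (Vec n) (Vec n))) := by
    intro t w hp
    have h1 : HasFDerivAt (momentum L) (fderiv ℝ (momentum L) (F (t, w))) (F (t, w)) :=
      ((momentum_contDiff hL).differentiable (by norm_num)).differentiableAt.hasFDerivAt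
    have h2 : HasDerivAt (fun s => momentum L (F (s, w))) _ t :=
      HasFDerivAt.comp_hasDerivAt (l := momentum L) (f := fun s => F (s, w)) t h1
        (F_time ho hF hp)
    exact h2.unique (hel w t hp)
  have k1 := key t w hp
  have k2 := key 0 (F (t, w)) (h0 _)
  rw [hinit, ← k1] at k2
  have f1 := F_time_fst ho hF hvel hp
  have f2 := F_time_fst ho hF hvel (h0 (F (t, w)))
  rw [hinit, ← f1] at f2
  have e : fderiv ℝ F (0, F (t, w)) (1, 0) = fderiv ℝ F (t, w) (1, 0) := by
    have h3 : fderiv ℝ F (0, F (t, w)) (1, 0) - fderiv ℝ F (t, w) (1, 0) =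
        (0, (fderiv ℝ F (0, F (t, w)) (1, 0)).2 - (fderiv ℝ F (t, w) (1, 0)).2) := by
      ext1
      · simp [f2]
      · simp
    have h4 := momentum_inj hL hreg (F (t, w)) _ (by rw [← h3, map_sub, k2, sub_self])
    rw [← sub_eq_zero, h3, h4]; rfl
  rw [e]; exact F_time ho hF hp

lemma F_group (ho : IsOpen dom) (hF : ContDiffOn ℝ 2 F dom)
    (h0 : ∀ w, (0, w) ∈ dom) (hinit : ∀ w, F (0, w) = w)
    (hode : ∀ t w, (t, w) ∈ dom →
      HasDerivAt (fun s => F (s, w)) (fderiv ℝ F (0, F (t, w)) (1, 0)) t) (w0 : Phase n) :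
    ∃ δ > 0, ∀ s t w, |s| < δ → |t| < δ → dist w w0 < δ → F (t, F (s, w)) = F (s + t, w) := by
  have hX : ContDiffAt ℝ 1 (fun z => fderiv ℝ F (0, z) (1, 0)) w0 := by
    have h1 : ContDiffAt ℝ 1 (fun z : Phase n => fderiv ℝ F (0, z)) w0 :=
      ContDiffAt.comp w0 (fderivF_contDiffAt ho hF (h0 w0)) (by fun_prop)
    exact h1.clm_apply contDiffAt_const
  obtain ⟨K, B, hB, hKB⟩ := hX.exists_lipschitzOnWith
  have hFc : ContinuousAt F (0, w0) := (F_hasFDerivAt ho hF (h0 w0)).continuousAt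
  have hB' : ∀ᶠ p in 𝓝 ((0:ℝ), w0), p ∈ dom ∧ F p ∈ B := by
    have h1 : ∀ᶠ p in 𝓝 ((0:ℝ), w0), p ∈ dom := ho.mem_nhds (h0 w0)
    have h2 : ∀ᶠ p in 𝓝 ((0:ℝ), w0), F p ∈ B := by
      apply hFc
      rw [hinit]; exact hB
    exact h1.and h2
  obtain ⟨ε, hε, hεB⟩ := Metric.eventually_nhds_iff.1 hB'
  have hB2 : ∀ᶠ p in 𝓝 ((0:ℝ), w0), dist (F p) w0 < ε := by
    have := hFc (Metric.ball_mem_nhds (F (0, w0)) hε)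
    rw [hinit] at this; exact this
  obtain ⟨η, hη, hηB⟩ := Metric.eventually_nhds_iff.1 hB2
  have hεB' : ∀ t w, |t| < ε → dist w w0 < ε → (t, w) ∈ dom ∧ F (t, w) ∈ B := by
    intro t w ht hw
    apply hεB
    rw [Prod.dist_eq]
    simpa using ⟨ht, hw⟩
  refine ⟨min η (ε / 2), by positivity, ?_⟩
  intro s t w hs ht hw
  rw [lt_min_iff] at hs ht hw
  have hz : dist (F (s, w)) w0 < ε := by
    apply hηB
    rw [Prod.dist_eq]
    simpa using ⟨hs.1, hw.1⟩
  have hwε : dist w w0 < ε := by linarith [hw.2]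
  have := ODE_solution_unique_of_mem_Ioo (a := -(ε/2)) (b := ε/2) (t₀ := 0)
    (v := fun _ z => fderiv ℝ F (0, z) (1, 0)) (s := fun _ => B) (K := K)
    (f := fun t => F (t, F (s, w))) (g := fun t => F (s + t, w))
    (fun _ _ => hKB) ⟨by linarith, by linarith⟩
    (by
      intro t ht
      have h1 := hεB' t (F (s, w)) (by rw [abs_lt]; constructor <;> linarith [ht.1, ht.2]) hz
      exact ⟨hode _ _ h1.1, h1.2⟩)
    (by
      intro t ht
      have hs2 := abs_lt.1 hs.2
      have h1 := hεB' (s + t) w (by rw [abs_lt]; constructor <;> linarith [ht.1, ht.2]) hwε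
      refine ⟨?_, h1.2⟩
      exact HasDerivAt.comp_const_add s t (hode _ _ h1.1))
    (by simp [hinit])
  exact this (by
    have := abs_lt.1 ht.2
    exact ⟨this.1, this.2⟩)

lemma action_deriv {L : Phase n → ℝ} (hL : ContDiff ℝ 2 L)
    (ho : IsOpen dom) (hF : ContDiffOn ℝ 2 F dom)
    (hvel : ∀ w t, (t, w) ∈ dom → HasDerivAt (fun s => (F (s, w)).1) ((F (t, w)).2) t)
    (hel : ∀ w t, (t, w) ∈ dom → HasDerivAt (fun s => momentum L (F (s, w)))
      ((fderiv ℝ L (F (t, w))).comp (ContinuousLinearMap.inl ℝ (Vec n) (Vec n))) t)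
    {w0 : Phase n} {ε C : ℝ} (hdom : ∀ t w, |t| < ε → dist w w0 < ε → (t, w) ∈ dom)
    (hC : ∀ t w, |t| < ε → dist w w0 < ε →
      ‖(fderiv ℝ L (F (t, w))).comp (spJac F (t, w))‖ ≤ C)
    {a b : ℝ} (ha : |a| < ε) (hb : |b| < ε) {w : Phase n} (hw : dist w w0 < ε) :
    HasFDerivAt (fun w => ∫ t in a..b, L (F (t, w)))
      ((momentum L (F (b, w))).comp (spJac1 F (b, w)) -
        (momentum L (F (a, w))).comp (spJac1 F (a, w))) w := by
  have hsub : ∀ t ∈ uIcc a b, |t| < ε := by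
    intro t ht
    rw [abs_lt] at *
    rcases le_total a b with h | h
    · rw [uIcc_of_le h] at ht
      constructor <;> linarith [ht.1, ht.2]
    · rw [uIcc_of_ge h] at ht
      constructor <;> linarith [ht.1, ht.2]
  have hLd : ∀ z, HasFDerivAt L (fderiv ℝ L z) z := fun z =>
    (hL.differentiable (by norm_num)).differentiableAt.hasFDerivAt
  have hLc : Continuous (fderiv ℝ L) := (hL.fderiv_right (m := 1) (by norm_num)).continuous
  have hmk : ∀ w : Phase n, Continuous (fun t : ℝ => (t, w)) := fun w => by fun_prop
  have hFc : ∀ w, dist w w0 < ε → ContinuousOn (fun t => F (t, w)) (uIcc a b) := by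
    intro w hw t ht
    exact (ContinuousAt.comp (f := fun t => (t, w))
      (F_hasFDerivAt ho hF (hdom t w (hsub t ht) hw)).continuousAt
      (hmk w).continuousAt).continuousWithinAt
  have hLFc : ∀ w, dist w w0 < ε → ContinuousOn (fun t => L (F (t, w))) (uIcc a b) :=
    fun w hw => hL.continuous.comp_continuousOn (hFc w hw)
  have hJc : ∀ w, dist w w0 < ε →
      ContinuousOn (fun t => (fderiv ℝ L (F (t, w))).comp (spJac F (t, w))) (uIcc a b) := by
    intro w hw
    refine (hLc.comp_continuousOn (hFc w hw)).clm_comp ?_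
    intro t ht
    exact (ContinuousAt.comp (f := fun t => (t, w))
      (spJac_continuousAt ho hF (hdom t w (hsub t ht) hw))
      (hmk w).continuousAt).continuousWithinAt
  have hmeas : MeasurableSet (uIoc a b) := measurableSet_uIoc
  have hball : ∀ᶠ x in 𝓝 w, dist x w0 < ε :=
    (Metric.isOpen_ball (x := w0) (ε := ε)).mem_nhds hw
  have main := intervalIntegral.hasFDerivAt_integral_of_dominated_of_fderiv_le
    (μ := MeasureTheory.volume) (𝕜 := ℝ) (a := a) (b := b) (s := ball w0 ε)
    (bound := fun _ => C) (F := fun w t => L (F (t, w)))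
    (F' := fun w t => (fderiv ℝ L (F (t, w))).comp (spJac F (t, w))) (x₀ := w)
    (Metric.isOpen_ball.mem_nhds hw)
    (by
      filter_upwards [hball] with x hx
      exact ((hLFc x hx).mono uIoc_subset_uIcc).aestronglyMeasurable hmeas)
    (hLFc w hw).intervalIntegrable
    (((hJc w hw).mono uIoc_subset_uIcc).aestronglyMeasurable hmeas)
    (Eventually.of_forall fun t ht x hx => hC t x (hsub t (uIoc_subset_uIcc ht)) hx)
    intervalIntegrable_const
    (Eventually.of_forall fun t ht x hx =>
      (hLd _).comp x (F_space ho hF (hdom t x (hsub t (uIoc_subset_uIcc ht)) hx)))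
  rw [intervalIntegral.integral_eq_sub_of_hasDerivAt
    (f := fun t => (momentum L (F (t, w))).comp (spJac1 F (t, w))) ?_
    (hJc w hw).intervalIntegrable] at main
  · exact main
  · intro t ht
    have hp := hdom t w (hsub t ht) hw
    have := (hel w t hp).clm_comp (spJac1_deriv ho hF hvel hp)
    refine this.congr_deriv (Eq.symm ?_)
    refine ContinuousLinearMap.ext fun δ => ?_
    simp only [momentum, spJac1, spJac2, ContinuousLinearMap.comp_apply,
      add_apply, ContinuousLinearMap.inr_apply, ContinuousLinearMap.inl_apply,
      ContinuousLinearMap.coe_fst', ContinuousLinearMap.coe_snd']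
    rw [← map_add (fderiv ℝ L (F (t, w)))]
    simp

lemma spJac_zero (ho : IsOpen dom) (hF : ContDiffOn ℝ 2 F dom)
    (h0 : ∀ w, (0, w) ∈ dom) (hinit : ∀ w, F (0, w) = w) (w : Phase n) :
    spJac F (0, w) = ContinuousLinearMap.id ℝ (Phase n) := by
  have h1 := F_space ho hF (h0 w)
  simp only [hinit] at h1
  exact h1.unique (hasFDerivAt_id w)

lemma boundary_surj (ho : IsOpen dom) (hF : ContDiffOn ℝ 2 F dom)
    (hvel : ∀ w t, (t, w) ∈ dom → HasDerivAt (fun s => (F (s, w)).1) ((F (t, w)).2) t)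
    {w0 : Phase n} {ε : ℝ} (hdom : ∀ t w, |t| < ε → dist w w0 < ε → (t, w) ∈ dom)
    (hC : ∀ t w, |t| < ε → dist w w0 < ε →
      ‖spJac F (t, w) - ContinuousLinearMap.id ℝ (Phase n)‖ ≤ 1 / 2)
    {a b : ℝ} (ha : |a| < ε) (hb : |b| < ε) (hab : a < b) {w : Phase n} (hw : dist w w0 < ε)
    (x y : Vec n) : ∃ δ, spJac1 F (a, w) δ = x ∧ spJac1 F (b, w) δ = y := by
  have hsub : ∀ t ∈ Icc a b, |t| < ε := by
    intro t ht
    rw [abs_lt] at *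
    constructor <;> linarith [ht.1, ht.2]
  have hmvt := (convex_Icc a b).norm_image_sub_le_of_norm_hasDerivWithin_le (C := 1 / 2)
    (f := fun t => spJac1 F (t, w) - t • ContinuousLinearMap.snd ℝ (Vec n) (Vec n))
    (f' := fun t => spJac2 F (t, w) - (1:ℝ) • ContinuousLinearMap.snd ℝ (Vec n) (Vec n))
    (fun t ht => ((spJac1_deriv ho hF hvel (hdom t w (hsub t ht) hw)).sub
      ((hasDerivAt_id t).smul_const _)).hasDerivWithinAt)
    (by
      intro t ht
      have h1 := hC t w (hsub t ht) hw
      refine ContinuousLinearMap.opNorm_le_bound _ (by norm_num) fun δ => ?_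
      have h2 := ContinuousLinearMap.le_of_opNorm_le _ h1 δ
      refine le_trans ?_ h2
      refine le_trans ?_ (norm_snd_le _)
      simp [spJac2])
    (left_mem_Icc.2 hab.le) (right_mem_Icc.2 hab.le)
  set h := b - a with hh
  have hpos : 0 < h := by linarith
  let T : Phase n →L[ℝ] Phase n := (spJac1 F (a, w)).prod (h⁻¹ • (spJac1 F (b, w) - spJac1 F (a, w)))
  have hT : ‖ContinuousLinearMap.id ℝ (Phase n) - T‖ ≤ 1 / 2 := by
    rw [norm_sub_rev]
    refine ContinuousLinearMap.opNorm_le_bound _ (by norm_num) fun δ => ?_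
    rw [Prod.norm_def]
    apply max_le
    · have h1 := hC a w ha hw
      have h2 := ContinuousLinearMap.le_of_opNorm_le _ h1 δ
      refine le_trans ?_ h2
      refine le_trans ?_ (norm_fst_le _)
      simp [spJac1, T]
    · have h2 := ContinuousLinearMap.le_of_opNorm_le _ hmvt δ
      have h3 : ((T - ContinuousLinearMap.id ℝ (Phase n)) δ).2 =
        h⁻¹ • ((spJac1 F (b, w) - b • ContinuousLinearMap.snd ℝ (Vec n) (Vec n) -
          (spJac1 F (a, w) - a • ContinuousLinearMap.snd ℝ (Vec n) (Vec n))) δ) := by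
        have h5 : δ.2 = h⁻¹ • (h • δ.2) := by
          rw [smul_smul, inv_mul_cancel₀ hpos.ne', one_smul]
        simp only [T, sub_apply, ContinuousLinearMap.prod_apply,
          smul_apply, ContinuousLinearMap.id_apply, Prod.snd_sub,
          ContinuousLinearMap.coe_snd']
        conv_lhs => rw [h5]
        rw [← smul_sub, hh]
        congr 1
        module
      rw [h3, norm_smul, norm_inv, Real.norm_of_nonneg hpos.le]
      rw [Real.norm_of_nonneg hpos.le] at h2
      calc _ ≤ h⁻¹ * (1 / 2 * h * ‖δ‖) := by gcongr
        _ = _ := by field_simp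
  have hu : IsUnit T := by
    have := isUnit_one_sub_of_norm_lt_one (x := ContinuousLinearMap.id ℝ (Phase n) - T)
      (by linarith)
    have e : (1 : Phase n →L[ℝ] Phase n) - (ContinuousLinearMap.id ℝ (Phase n) - T) = T := by
      rw [ContinuousLinearMap.one_def]; abel
    rwa [e] at this
  obtain ⟨u, hu⟩ := hu
  refine ⟨(↑u⁻¹ : Phase n →L[ℝ] Phase n) (x, h⁻¹ • (y - x)), ?_⟩
  set δ := (↑u⁻¹ : Phase n →L[ℝ] Phase n) (x, h⁻¹ • (y - x)) with hδ
  have hTδ : T δ = (x, h⁻¹ • (y - x)) := by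
    rw [hδ, ← hu, ← mul_apply_eq_comp, Units.mul_inv]; rfl
  have e1 : spJac1 F (a, w) δ = x := congrArg Prod.fst hTδ
  have e2 : h⁻¹ • (spJac1 F (b, w) δ - spJac1 F (a, w) δ) = h⁻¹ • (y - x) :=
    congrArg Prod.snd hTδ
  refine ⟨e1, ?_⟩
  have e3 := smul_right_injective _ (inv_ne_zero hpos.ne') e2
  rw [e1] at e3
  exact sub_left_injective e3

end Flow

/-- The exact discretization generates exactly the Euler–Lagrange flow:
near h = 0, a triple (h, v, ṽ) with h > 0 is critical iff ṽ = F_h(v). -/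
theorem stmt3 {n k : ℕ} (hk : 2 ≤ k) (L : Phase n → ℝ)
    (hL : ContDiff ℝ k L) (hreg : IsRegularLagrangian L)
    (Φ : ELFlow n L)
    (hΦ : ContDiffOn ℝ k (fun p : ℝ × Phase n => Φ.flow p.1 p.2) Φ.dom)
    (D : LDisc n k L)
    -- D is the exact discretization determined by the flow and α⁺, α⁻
    (hψ : ∀ (h t : ℝ) (w : Phase n), (h, t, w) ∈ D.toTBDisc.dom →
      D.toTBDisc.ψ h t w = (Φ.flow t w).1)
    (hLh : ∀ (h : ℝ) (w : Phase n), 0 ≤ h → h < D.toTBDisc.a →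
      D.Lh h w = ∫ t in (D.toTBDisc.αm h)..(D.toTBDisc.αp h), L (Φ.flow t w)) :
    ∃ U : Set (ℝ × Phase n × Phase n), IsOpen U ∧
      (∀ w : Phase n, ((0:ℝ), w, w) ∈ U) ∧
      ∀ (h : ℝ) (v vt : Phase n), (h, v, vt) ∈ U → 0 < h →
        (vt = Φ.flow h v ↔
          IsCriticalPt D.toTBDisc.bp D.toTBDisc.bm D.Lh h v vt) := by
  have h2k : (2 : WithTop ℕ∞) ≤ (k : WithTop ℕ∞) := by exact_mod_cast hk
  have hL2 : ContDiff ℝ 2 L := hL.of_le h2k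
  set F : ℝ × Phase n → Phase n := fun p => Φ.flow p.1 p.2 with hFdef
  have hF : ContDiffOn ℝ 2 F Φ.dom := hΦ.of_le h2k
  have ho := Φ.dom_open
  have h0 := Φ.dom_zero
  have hinit : ∀ w, F (0, w) = w := Φ.init
  have hvel : ∀ w t, (t, w) ∈ Φ.dom →
      HasDerivAt (fun s => (F (s, w)).1) ((F (t, w)).2) t := Φ.vel
  have hel : ∀ w t, (t, w) ∈ Φ.dom → HasDerivAt (fun s => momentum L (F (s, w)))
      ((fderiv ℝ L (F (t, w))).comp (ContinuousLinearMap.inl ℝ (Vec n) (Vec n))) t := by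
    intro w t hp
    have h1 := Φ.el w t hp
    simp only [fderiv_fib hL2, fderiv_base hL2] at h1
    exact h1
  have hode := fun t w (hp : (t, w) ∈ Φ.dom) =>
    F_ode hL2 hreg ho hF hvel hel h0 hinit hp
  suffices key : ∀ w0 : Phase n, ∀ᶠ x : ℝ × Phase n × Phase n in 𝓝 (0, w0, w0), 0 < x.1 →
      (x.2.2 = Φ.flow x.1 x.2.1 ↔
        IsCriticalPt D.toTBDisc.bp D.toTBDisc.bm D.Lh x.1 x.2.1 x.2.2) by
    refine ⟨interior {x : ℝ × Phase n × Phase n | 0 < x.1 → (x.2.2 = Φ.flow x.1 x.2.1 ↔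
        IsCriticalPt D.toTBDisc.bp D.toTBDisc.bm D.Lh x.1 x.2.1 x.2.2)}, isOpen_interior, ?_, ?_⟩
    · intro w
      exact mem_interior_iff_mem_nhds.2 (key w)
    · intro h v vt hx hpos
      exact interior_subset hx hpos
  intro w0
  obtain ⟨δ, hδ, hgroup⟩ := F_group ho hF h0 hinit hode w0
  obtain ⟨η, hη, hinj⟩ := Metric.eventually_nhds_iff.1 (momentum_locInj hL2 hreg w0)
  obtain ⟨ε₁, hε₁, hdomψ⟩ := Metric.eventually_nhds_iff.1
    (show ∀ᶠ p in 𝓝 ((0:ℝ), (0:ℝ), w0), p ∈ D.toTBDisc.dom from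
      D.toTBDisc.dom_open.mem_nhds (D.toTBDisc.dom_zero w0))
  have hFc : ContinuousAt F (0, w0) := (F_hasFDerivAt ho hF (h0 w0)).continuousAt
  have hJc : ContinuousAt (spJac F) (0, w0) := spJac_continuousAt ho hF (h0 w0)
  have hLc : Continuous (fderiv ℝ L) := (hL2.fderiv_right (m := 1) (by norm_num)).continuous
  have hLJc : ContinuousAt (fun p => ‖(fderiv ℝ L (F p)).comp (spJac F p)‖) (0, w0) :=
    ((hLc.continuousAt.comp hFc).clm_comp hJc).norm
  have e1 : ∀ᶠ p in 𝓝 ((0:ℝ), w0), p ∈ Φ.dom := ho.mem_nhds (h0 w0)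
  have e2 : ∀ᶠ p in 𝓝 ((0:ℝ), w0), dist (F p) w0 < η := by
    have h1 := hFc (Metric.ball_mem_nhds (F (0, w0)) hη)
    rw [hinit] at h1; exact h1
  obtain ⟨C, hCgt⟩ := exists_gt ‖(fderiv ℝ L (F (0, w0))).comp (spJac F (0, w0))‖
  have e3 : ∀ᶠ p in 𝓝 ((0:ℝ), w0), ‖(fderiv ℝ L (F p)).comp (spJac F p)‖ < C :=
    hLJc.eventually_lt continuousAt_const hCgt
  have e4 : ∀ᶠ p in 𝓝 ((0:ℝ), w0),
      ‖spJac F p - ContinuousLinearMap.id ℝ (Phase n)‖ < 1 / 2 := by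
    have h1 : ContinuousAt (fun p => ‖spJac F p - ContinuousLinearMap.id ℝ (Phase n)‖) (0, w0) :=
      (hJc.sub continuousAt_const).norm
    refine h1.eventually_lt continuousAt_const ?_
    rw [spJac_zero ho hF h0 hinit]
    simp
  obtain ⟨ε₂, hε₂, hall⟩ := Metric.eventually_nhds_iff.1 (e1.and (e2.and (e3.and e4)))
  set ε := min (min δ D.toTBDisc.a) (min ε₁ ε₂) with hεdef
  have hε : 0 < ε := by
    have := D.toTBDisc.a_pos
    positivity
  have hεδ : ε ≤ δ := (min_le_left _ _).trans (min_le_left _ _)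
  have hεa : ε ≤ D.toTBDisc.a := (min_le_left _ _).trans (min_le_right _ _)
  have hε1 : ε ≤ ε₁ := (min_le_right _ _).trans (min_le_left _ _)
  have hε2 : ε ≤ ε₂ := (min_le_right _ _).trans (min_le_right _ _)
  have hall' : ∀ t w, |t| < ε → dist w w0 < ε → (t, w) ∈ Φ.dom ∧ dist (F (t, w)) w0 < η ∧
      ‖(fderiv ℝ L (F (t, w))).comp (spJac F (t, w))‖ < C ∧
      ‖spJac F (t, w) - ContinuousLinearMap.id ℝ (Phase n)‖ < 1 / 2 := by
    intro t w ht hw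
    apply hall
    rw [Prod.dist_eq]
    simpa using ⟨ht.trans_le hε2, hw.trans_le hε2⟩
  have hdom : ∀ t w, |t| < ε → dist w w0 < ε → (t, w) ∈ Φ.dom :=
    fun t w ht hw => (hall' t w ht hw).1
  refine Metric.eventually_nhds_iff.2 ⟨ε, hε, ?_⟩
  rintro ⟨h, v, vt⟩ hx hpos
  simp only at hpos ⊢
  simp only [Prod.dist_eq, max_lt_iff, Real.dist_eq, sub_zero] at hx
  obtain ⟨hhε, hv, hvt⟩ := hx
  have hv : dist v w0 < ε := by rw [Prod.dist_eq]; exact max_lt hv.1 hv.2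
  have hvt : dist vt w0 < ε := by rw [Prod.dist_eq]; exact max_lt hvt.1 hvt.2
  have hh : h < ε := (le_abs_self h).trans_lt hhε
  have hIco : h ∈ Ico 0 D.toTBDisc.a := ⟨hpos.le, hh.trans_le hεa⟩
  have ap := D.toTBDisc.αp_nonneg h hIco
  have am := D.toTBDisc.αm_nonpos h hIco
  have asub := D.toTBDisc.α_sub h hIco
  set b := D.toTBDisc.αp h with hb
  set a := D.toTBDisc.αm h with ha
  have hbε : |b| < ε := by rw [abs_lt]; constructor <;> linarith
  have haε : |a| < ε := by rw [abs_lt]; constructor <;> linarith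
  have hψ' : ∀ t w, |t| < ε → dist w w0 < ε → D.toTBDisc.ψ h t w = (F (t, w)).1 := by
    intro t w ht hw
    refine hψ h t w (hdomψ ?_)
    simp only [Prod.dist_eq (α := ℝ), max_lt_iff, Real.dist_eq, sub_zero]
    exact ⟨hhε.trans_le hε1, ht.trans_le hε1, hw.trans_le hε1⟩
  have hball : ∀ w, dist w w0 < ε → ∀ᶠ x in 𝓝 w, dist x w0 < ε := fun w hw =>
    (Metric.isOpen_ball (x := w0) (ε := ε)).mem_nhds hw
  have hbp : ∀ w, dist w w0 < ε → fderiv ℝ (D.toTBDisc.bp h) w = spJac1 F (b, w) := by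
    intro w hw
    have h1 : HasFDerivAt (fun w => (F (b, w)).1) (spJac1 F (b, w)) w :=
      (F_space ho hF (hdom b w hbε hw)).fst
    refine (h1.congr_of_eventuallyEq ?_).fderiv
    filter_upwards [hball w hw] with x hx
    exact hψ' b x hbε hx
  have hbm : ∀ w, dist w w0 < ε → fderiv ℝ (D.toTBDisc.bm h) w = spJac1 F (a, w) := by
    intro w hw
    have h1 : HasFDerivAt (fun w => (F (a, w)).1) (spJac1 F (a, w)) w :=
      (F_space ho hF (hdom a w haε hw)).fst
    refine (h1.congr_of_eventuallyEq ?_).fderiv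
    filter_upwards [hball w hw] with x hx
    exact hψ' a x haε hx
  have hLd : ∀ w, dist w w0 < ε → fderiv ℝ (D.Lh h) w =
      (momentum L (F (b, w))).comp (spJac1 F (b, w)) -
        (momentum L (F (a, w))).comp (spJac1 F (a, w)) := by
    intro w hw
    have h1 := action_deriv hL2 ho hF hvel hel hdom
      (fun t w ht hw => (hall' t w ht hw).2.2.1.le) haε hbε hw
    have h2 : D.Lh h = fun w => ∫ t in a..b, L (F (t, w)) := by
      funext w
      exact hLh h w hIco.1 hIco.2
    rw [h2]
    exact h1.fderiv
  have hsurj : ∀ w, dist w w0 < ε → ∀ x y, ∃ δ, spJac1 F (a, w) δ = x ∧ spJac1 F (b, w) δ = y :=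
    fun w hw x y => boundary_surj ho hF hvel hdom
      (fun t w ht hw => (hall' t w ht hw).2.2.2.le) haε hbε (by linarith) hw x y
  have hbpv : D.toTBDisc.bp h v = (F (b, v)).1 := hψ' b v hbε hv
  have hbmv : D.toTBDisc.bm h vt = (F (a, vt)).1 := hψ' a vt haε hvt
  have step1 : vt = Φ.flow h v ↔ F (b, v) = F (a, vt) := by
    change vt = F (h, v) ↔ _
    constructor
    · intro e
      rw [e, hgroup h a v (hhε.trans_le hεδ) (haε.trans_le hεδ) (hv.trans_le hεδ)]
      congr 2
      linarith
    · intro e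
      have g1 := hgroup b (-a) v (hbε.trans_le hεδ) (by rw [abs_neg]; exact haε.trans_le hεδ)
        (hv.trans_le hεδ)
      have g2 := hgroup a (-a) vt (haε.trans_le hεδ) (by rw [abs_neg]; exact haε.trans_le hεδ)
        (hvt.trans_le hεδ)
      rw [e, g2, add_neg_cancel, hinit] at g1
      rw [g1, ← sub_eq_add_neg, asub]
  rw [step1]
  constructor
  · intro e
    refine ⟨by rw [hbpv, hbmv, e], ?_⟩
    intro δv δvt c1 c2 c3
    rw [hbm v hv] at c1
    rw [hbp vt hvt] at c2
    rw [hbp v hv, hbm vt hvt] at c3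
    rw [hLd v hv, hLd vt hvt]
    simp only [sub_apply, ContinuousLinearMap.comp_apply, c1, c2, c3, e, map_zero]
    ring
  · rintro ⟨c0, c⟩
    rw [hbpv, hbmv] at c0
    refine hinj (y := (F (b, v), F (a, vt))) ?_ c0 ?_
    · rw [Prod.dist_eq]
      exact max_lt (hall' b v hbε hv).2.1 (hall' a vt haε hvt).2.1
    · refine ContinuousLinearMap.ext fun x => ?_
      obtain ⟨δv, d1, d2⟩ := hsurj v hv 0 x
      obtain ⟨δvt, d3, d4⟩ := hsurj vt hvt x 0
      have c1 := c δv δvt (by rw [hbm v hv, d1]) (by rw [hbp vt hvt, d4])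
        (by rw [hbp v hv, hbm vt hvt, d2, d3])
      rw [hLd v hv, hLd vt hvt] at c1
      simp only [sub_apply, ContinuousLinearMap.comp_apply, d1, d2, d3, d4, map_zero] at c1
      linarith

end
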